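/- Let A > 0 be a real number and a ∈ ℝ. Then (1/(2π)) ∫_ℝ e^{iaξ} / (A² + ξ²) dξ = e^{−|a|A} / (2A). -/

import Mathlib

open MeasureTheory Complex

open scoped FourierTransform

theorem integrable_inv_sq_add_sq {A : ℝ} (hA : A ≠ 0) :
    Integrable fun ξ : ℝ => (A ^ 2 + ξ ^ 2)⁻¹ := by
  convert (integrable_inv_one_add_sq.comp_mul_left' (inv_ne_zero hA)).const_mul (A ^ 2)⁻¹
    using 2 with ξ
  rw [← mul_inv]
  congr 1
  field_simp

theorem integrable_exp_mul_I_div_sq_add_sq {A : ℝ} (hA : A ≠ 0) (a : ℝ) :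
    Integrable fun ξ : ℝ => exp (I * (a : ℂ) * (ξ : ℂ)) / ((A : ℂ) ^ 2 + (ξ : ℂ) ^ 2) := by
  refine (integrable_inv_sq_add_sq hA).mono' (Measurable.aestronglyMeasurable (by fun_prop))
    (ae_of_all _ fun ξ => le_of_eq ?_)
  have hexp : ‖exp (I * (a : ℂ) * (ξ : ℂ))‖ = 1 := by
    rw [mul_assoc, ← ofReal_mul, norm_exp_I_mul_ofReal]
  have hden : ‖(A : ℂ) ^ 2 + (ξ : ℂ) ^ 2‖ = A ^ 2 + ξ ^ 2 := by
    rw [← ofReal_pow, ← ofReal_pow, ← ofReal_add, norm_real, Real.norm_of_nonneg (by positivity)]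
  rw [norm_div, hexp, hden, one_div]

section

variable {A : ℝ} (t : ℝ)

theorem exp_neg_mul_abs_mul_exp_eqOn_Iic :
    Set.EqOn (fun x : ℝ => exp (-(t * x) * I) * exp (-((|x| * A : ℝ) : ℂ)))
      (fun x : ℝ => exp ((A - t * I) * x)) (Set.Iic 0) := fun x hx => by
  simp only [← exp_add, abs_of_nonpos (Set.mem_Iic.1 hx)]
  push_cast
  ring_nf

theorem exp_neg_mul_abs_mul_exp_eqOn_Ioi :
    Set.EqOn (fun x : ℝ => exp (-(t * x) * I) * exp (-((|x| * A : ℝ) : ℂ)))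
      (fun x : ℝ => exp ((-A - t * I) * x)) (Set.Ioi 0) := fun x hx => by
  simp only [← exp_add, abs_of_pos (Set.mem_Ioi.1 hx)]
  push_cast
  ring_nf

theorem integrableOn_Iic_exp_mul_exp_neg_mul_abs (hA : 0 < A) :
    IntegrableOn (fun x : ℝ => exp (-(t * x) * I) * exp (-((|x| * A : ℝ) : ℂ))) (Set.Iic 0) :=
  (integrableOn_exp_mul_complex_Iic (by simpa using hA) 0).congr_fun
    (exp_neg_mul_abs_mul_exp_eqOn_Iic t).symm measurableSet_Iic

theorem integrableOn_Ioi_exp_mul_exp_neg_mul_abs (hA : 0 < A) :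
    IntegrableOn (fun x : ℝ => exp (-(t * x) * I) * exp (-((|x| * A : ℝ) : ℂ))) (Set.Ioi 0) :=
  (integrableOn_exp_mul_complex_Ioi (by simpa using hA) 0).congr_fun
    (exp_neg_mul_abs_mul_exp_eqOn_Ioi t).symm measurableSet_Ioi

theorem integral_exp_mul_exp_neg_mul_abs (hA : 0 < A) :
    ∫ x : ℝ, exp (-(t * x) * I) * exp (-((|x| * A : ℝ) : ℂ)) =
      2 * A / ((A : ℂ) ^ 2 + (t : ℂ) ^ 2) := by
  rw [← intervalIntegral.integral_Iic_add_Ioi (integrableOn_Iic_exp_mul_exp_neg_mul_abs t hA)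
      (integrableOn_Ioi_exp_mul_exp_neg_mul_abs t hA),
    setIntegral_congr_fun measurableSet_Iic (exp_neg_mul_abs_mul_exp_eqOn_Iic t),
    setIntegral_congr_fun measurableSet_Ioi (exp_neg_mul_abs_mul_exp_eqOn_Ioi t),
    integral_exp_mul_complex_Iic (by simpa using hA),
    integral_exp_mul_complex_Ioi (by simpa using hA)]
  have hminus : (A : ℂ) - t * I ≠ 0 := fun h => hA.ne' (by simpa using congrArg re h)
  have hplus : (A : ℂ) + t * I ≠ 0 := fun h => hA.ne' (by simpa using congrArg re h)
  have hfactor : (A : ℂ) ^ 2 + (t : ℂ) ^ 2 = (A - t * I) * (A + t * I) := by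
    linear_combination (t : ℂ) ^ 2 * I_sq
  rw [hfactor, show -(A : ℂ) - t * I = -(A + t * I) by ring]
  simp only [ofReal_zero, mul_zero, exp_zero]
  field_simp
  ring

end

theorem integrable_exp_neg_abs_mul {A : ℝ} (hA : 0 < A) :
    Integrable fun x : ℝ => exp (-((|x| * A : ℝ) : ℂ)) := by
  have h := (integrableOn_Iic_exp_mul_exp_neg_mul_abs 0 hA).union
    (integrableOn_Ioi_exp_mul_exp_neg_mul_abs 0 hA)
  rw [Set.Iic_union_Ioi, integrableOn_univ] at h
  simpa using h

theorem fourier_exp_neg_abs_mul {A : ℝ} (hA : 0 < A) :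
    𝓕 (fun x : ℝ => exp (-((|x| * A : ℝ) : ℂ))) =
      fun w : ℝ => 2 * A / ((A : ℂ) ^ 2 + ((2 * Real.pi * w : ℝ) : ℂ) ^ 2) := by
  ext w
  rw [Real.fourier_real_eq_integral_exp_smul, ← integral_exp_mul_exp_neg_mul_abs _ hA]
  congr 1 with x
  rw [smul_eq_mul]
  congr 2
  push_cast
  ring

/-- for `A > 0` and `a ∈ ℝ`,
`(1/(2π)) ∫_ℝ e^{iaξ}/(A² + ξ²) dξ = e^{−|a|A}/(2A)` (an absolutely convergent Lebesgue
integral of a complex-valued function). -/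
theorem statement8 (A : ℝ) (hA : 0 < A) (a : ℝ) :
    Integrable (fun ξ : ℝ =>
      Complex.exp (Complex.I * (a : ℂ) * (ξ : ℂ)) / ((A : ℂ) ^ 2 + (ξ : ℂ) ^ 2)) ∧
    (1 / (2 * (Real.pi : ℂ))) *
        ∫ ξ : ℝ, Complex.exp (Complex.I * (a : ℂ) * (ξ : ℂ)) / ((A : ℂ) ^ 2 + (ξ : ℂ) ^ 2)
      = Complex.exp (-((|a| * A : ℝ) : ℂ)) / (2 * (A : ℂ)) := by
  refine ⟨integrable_exp_mul_I_div_sq_add_sq hA.ne' a, ?_⟩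
  have hpi : (2 * Real.pi : ℝ) ≠ 0 := by positivity
  have hfourier : Integrable (𝓕 fun x : ℝ => exp (-((|x| * A : ℝ) : ℂ))) := by
    rw [fourier_exp_neg_abs_mul hA]
    simpa [div_eq_mul_inv] using
      ((integrable_exp_mul_I_div_sq_add_sq hA.ne' 0).comp_mul_left' hpi).const_mul (2 * A : ℂ)
  have hinv := (integrable_exp_neg_abs_mul hA).fourierInv_fourier_eq hfourier (v := a)
    (by fun_prop)
  have hscale := Measure.integral_comp_mul_left
    (fun ξ : ℝ => exp (I * (a : ℂ) * (ξ : ℂ)) / ((A : ℂ) ^ 2 + (ξ : ℂ) ^ 2)) (2 * Real.pi)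
  rw [abs_of_pos (by positivity), real_smul] at hscale
  rw [fourier_exp_neg_abs_mul hA, Real.fourierInv_eq'] at hinv
  rw [← hinv, eq_div_iff (by simpa using hA.ne'), one_div,
    show ((2 : ℂ) * Real.pi)⁻¹ = (((2 * Real.pi)⁻¹ : ℝ) : ℂ) by push_cast; rfl,
    ← hscale, ← integral_mul_const]
  congr 1 with w
  simp only [smul_eq_mul, RCLike.inner_apply, conj_trivial]
  rw [show I * (a : ℂ) * ((2 * Real.pi * w : ℝ) : ℂ) = ((2 * Real.pi * (a * w) : ℝ) : ℂ) * I by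
    push_cast; ring]
  ring
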